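/- Let c be a fully invariant congruence on the free monoid M = FreeMonoid ℕ with c ≠ ⊥. If c is an upper-modular element of the lattice L of fully invariant congruences on M, then there exist n ≥ 1 and m ≥ 1 such that c relates x^n and x^(n+m), where x = FreeMonoid.of 0. (Dual rendering of the paper's lemma: a proper monoid variety that is a lower-modular element of 𝕄𝕆ℕ is periodic, i.e., satisfies an identity x^n ≈ x^(n+m).) -/

import Mathlib

/-- The free monoid over a countably infinite alphabet. -/
abbrev M : Type := FreeMonoid ℕ

/-- A congruence on the free monoid is fully invariant if it is stable under
all endomorphisms of the free monoid. -/
def FullyInvariant (c : Con M) : Prop :=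
  ∀ f : M →* M, ∀ u v : M, c u v → c (f u) (f v)

/-- The least fully invariant congruence containing a given set of pairs. -/
def fiClosure (S : Set (M × M)) : Con M :=
  sInf {c : Con M | FullyInvariant c ∧ ∀ p ∈ S, c p.1 p.2}

def x : M := FreeMonoid.of 0
def y : M := FreeMonoid.of 1

/-- `c` is an upper-modular element of the lattice of fully invariant congruences. -/
def IsUpperModularElem (c : Con M) : Prop :=
  ∀ b d : Con M, FullyInvariant b → FullyInvariant d → b ≤ c →
    c ⊓ (b ⊔ d) = b ⊔ (c ⊓ d)

/-- The Rees congruence collapsing all words of length greater than `N`. -/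
def longWordsCon (N : ℕ) : Con M where
  r p q := p = q ∨ (N < p.length ∧ N < q.length)
  iseqv := ⟨fun _ => Or.inl rfl, by grind, by grind⟩
  mul' := by
    intro p q r s h₁ h₂
    simp only [FreeMonoid.length_mul]
    grind

/-- The largest fully invariant congruence contained in a given congruence. -/
def fullyInvariantCore (e : Con M) : Con M where
  r p q := ∀ f : M →* M, e (f p) (f q)
  iseqv := ⟨fun p f => e.refl (f p), fun h f => e.symm (h f), fun h₁ h₂ f => e.trans (h₁ f) (h₂ f)⟩
  mul' := by
    intro p q r s h₁ h₂ f
    simpa only [map_mul] using e.mul (h₁ f) (h₂ f)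

theorem fullyInvariantCore_le (e : Con M) : fullyInvariantCore e ≤ e :=
  fun {_ _} h => h (MonoidHom.id M)

theorem fullyInvariant_fullyInvariantCore (e : Con M) : FullyInvariant (fullyInvariantCore e) :=
  fun f _ _ h g => h (g.comp f)

theorem FullyInvariant.inf {c d : Con M} (hc : FullyInvariant c) (hd : FullyInvariant d) :
    FullyInvariant (c ⊓ d) :=
  fun f u v h => ⟨hc f u v h.1, hd f u v h.2⟩

/-- The congruence of all identities satisfied by the monoid `G`. -/
def identitiesOf (G : Type*) [Monoid G] : Con M where
  r p q := ∀ f : M →* G, f p = f q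
  iseqv := ⟨fun _ _ => rfl, fun h f => (h f).symm, fun h₁ h₂ f => (h₁ f).trans (h₂ f)⟩
  mul' := by
    intro p q r s h₁ h₂ f
    rw [map_mul, map_mul, h₁ f, h₂ f]

theorem fullyInvariant_identitiesOf (G : Type*) [Monoid G] : FullyInvariant (identitiesOf G) :=
  fun f _ _ h g => h (g.comp f)

theorem identitiesOf_pow_card_succ (G : Type*) [Group G] (u : M) :
    identitiesOf G u (u ^ (Nat.card G + 1)) := by
  intro f
  rw [map_pow, pow_succ, pow_card_eq_one', one_mul]

/-- The permutation `t ↦ k + 2 * t` of `ZMod n`, for odd `n`. -/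
def appendDigit {n : ℕ} (hn : Nat.Coprime 2 n) (k : ℕ) : Equiv.Perm (ZMod n) :=
  (Units.mulLeft (ZMod.unitOfCoprime 2 hn)).trans (Equiv.addLeft (k : ZMod n))

theorem lift_appendDigit_zero {n : ℕ} (hn : Nat.Coprime 2 n) (g : ℕ → ℕ) (l : List ℕ) :
    FreeMonoid.lift (fun i => appendDigit hn (g i)) (FreeMonoid.ofList l) 0 =
      ((Nat.ofDigits 2 (l.map g) : ℕ) : ZMod n) := by
  induction l with
  | nil => simp [Nat.ofDigits_nil]
  | cons a l ih =>
    rw [FreeMonoid.ofList_cons, map_mul, Equiv.Perm.mul_apply, ih]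
    simp [appendDigit, Nat.ofDigits_cons]

theorem eq_of_forall_indicator_map_eq {p q : List ℕ}
    (h : ∀ a : ℕ, p.map (fun i => if i = a then 1 else 0) =
      q.map (fun i => if i = a then 1 else 0)) : p = q := by
  have hl : p.length = q.length := by simpa using congrArg List.length (h 0)
  refine List.ext_getElem hl fun i hp hq => ?_
  have := List.getElem_of_eq (h p[i]) (i := i) (by simpa using hp)
  simp only [List.getElem_map, if_true] at this
  by_contra hne
  rw [if_neg (Ne.symm hne)] at this
  exact one_ne_zero this

/-- Words of a given length are determined by the identities of the group of permutations of
`ZMod n`, provided `n` is odd and large enough. -/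
theorem eq_of_identitiesOf_perm {n : ℕ} (hn : Nat.Coprime 2 n) {p q : M}
    (hl : p.length = q.length) (hlt : 2 ^ p.length ≤ n)
    (h : identitiesOf (Equiv.Perm (ZMod n)) p q) : p = q := by
  apply FreeMonoid.toList.injective
  apply eq_of_forall_indicator_map_eq
  intro a
  set g : ℕ → ℕ := fun i => if i = a then 1 else 0 with hg
  have hdig (l : List ℕ) : ∀ k ∈ l.map g, k < 2 := by
    intro k hk
    obtain ⟨i, -, rfl⟩ := List.mem_map.1 hk
    simp only [hg]
    split_ifs <;> norm_num
  have hlt' (r : M) (hr : r.length = p.length) : Nat.ofDigits 2 (r.toList.map g) < n := by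
    refine (Nat.ofDigits_lt_base_pow_length one_lt_two (hdig _)).trans_le ?_
    rw [List.length_map]
    exact (congrArg (2 ^ ·) hr).trans_le hlt
  have h0 := DFunLike.congr_fun (h (FreeMonoid.lift fun i => appendDigit hn (g i))) 0
  have hp := lift_appendDigit_zero hn g p.toList
  have hq := lift_appendDigit_zero hn g q.toList
  rw [FreeMonoid.ofList_toList] at hp hq
  rw [hp, hq, ZMod.natCast_eq_natCast_iff', Nat.mod_eq_of_lt (hlt' p rfl),
    Nat.mod_eq_of_lt (hlt' q hl.symm)] at h0
  exact Nat.ofDigits_inj_of_len_eq one_lt_two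
    (by rw [List.length_map, List.length_map]; exact hl) (hdig _) (hdig _) h0

theorem length_pow (w : M) (k : ℕ) : (w ^ k).length = k * w.length := by
  induction k with
  | zero => simp
  | succ k ih => rw [pow_succ, FreeMonoid.length_mul, ih, Nat.succ_mul]

theorem lift_const_eq_pow_length (a p : M) :
    FreeMonoid.lift (fun _ : ℕ => a) p = a ^ p.length := by
  induction p using FreeMonoid.inductionOn' with
  | one => simp
  | of_mul i p ih => simp [FreeMonoid.length_mul, ih, pow_add]

theorem periodic_of_length_lt {c : Con M} (hc : FullyInvariant c) {p q : M} (h : c p q)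
    (hlt : p.length < q.length) : ∃ n ≥ 1, ∃ m ≥ 1, c (x ^ n) (x ^ (n + m)) := by
  refine ⟨p.length + 1, by omega, q.length - p.length, by omega, ?_⟩
  have h₁ := hc (FreeMonoid.lift fun _ => x) p q h
  rw [lift_const_eq_pow_length, lift_const_eq_pow_length] at h₁
  have h₂ := c.mul h₁ (c.refl x)
  rw [← pow_succ, ← pow_succ] at h₂
  convert h₂ using 2
  omega

/-- A nontrivial fully invariant congruence that is an upper-modular element of
the lattice of fully invariant congruences relates `x^n` and `x^(n+m)` for some
`n, m ≥ 1`. (Dual rendering of: a proper monoid variety that is a lower-modular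
element of 𝕄𝕆ℕ is periodic.) -/
theorem upperModular_is_periodic (c : Con M) (hc : FullyInvariant c)
    (hne : c ≠ ⊥) (hum : IsUpperModularElem c) :
    ∃ n ≥ 1, ∃ m ≥ 1, c (x ^ n) (x ^ (n + m)) := by
  by_contra hper
  have hlen {p q : M} (h : c p q) : p.length = q.length := by
    by_contra hpq
    rcases lt_or_gt_of_ne hpq with hlt | hlt
    · exact hper (periodic_of_length_lt hc h hlt)
    · exact hper (periodic_of_length_lt hc (c.symm h) hlt)
  have hex : ∃ N, ∃ p q : M, c p q ∧ p ≠ q ∧ p.length = N := by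
    by_contra! hcon
    refine hne (le_bot_iff.1 fun {p q} h => ?_)
    by_contra hpq
    exact hcon _ p q h hpq rfl
  classical
  obtain ⟨u, v, huv, huv_ne, hN⟩ := Nat.find_spec hex
  have hmin {p q : M} (h : c p q) (hpq : p ≠ q) : Nat.find hex ≤ p.length :=
    Nat.find_min' hex ⟨p, q, h, hpq, rfl⟩
  generalize Nat.find hex = N at hN hmin
  have hvN : v.length = N := (hlen huv).symm.trans hN
  have hpos : 0 < N := by
    rw [Nat.pos_iff_ne_zero]
    rintro rfl
    exact huv_ne ((FreeMonoid.length_eq_zero.1 hN).trans (FreeMonoid.length_eq_zero.1 hvN).symm)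
  let n := 2 ^ (N + 1) + 1
  have hn : Nat.Coprime 2 n := by
    rw [Nat.coprime_two_left]
    exact (Nat.even_pow.2 ⟨even_two, by omega⟩).add_one
  have : NeZero n := ⟨by omega⟩
  let G := Equiv.Perm (ZMod n)
  let b : Con M := c ⊓ fullyInvariantCore (longWordsCon N)
  let d : Con M := identitiesOf G
  have hb : FullyInvariant b := hc.inf (fullyInvariant_fullyInvariantCore _)
  have hd : FullyInvariant d := fullyInvariant_identitiesOf G
  have hle : b ⊔ (c ⊓ d) ≤ longWordsCon N := by
    refine sup_le (inf_le_right.trans (fullyInvariantCore_le _)) fun {p q} h => ?_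
    by_cases hp : N < p.length
    · exact Or.inr ⟨hp, hlen h.1 ▸ hp⟩
    · have hpow : 2 ^ p.length ≤ 2 ^ (N + 1) := Nat.pow_le_pow_right two_pos (by omega)
      exact Or.inl (eq_of_identitiesOf_perm hn (hlen h.1) (by omega) h.2)
  have hpow_b : b (u ^ (Nat.card G + 1)) (v ^ (Nat.card G + 1)) := by
    refine ⟨c.pow _ huv, fun f => ?_⟩
    have hf := hc f u v huv
    change longWordsCon N (f (u ^ _)) (f (v ^ _))
    rw [map_pow f, map_pow f]
    by_cases hfe : f u = f v
    · exact Or.inl (by rw [hfe])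
    · have hG : 0 < Nat.card G := Nat.card_pos
      have hu := hmin hf hfe
      have hv := hu.trans_eq (hlen hf)
      have hpow_length (w : M) (hw : N ≤ w.length) : N < (w ^ (Nat.card G + 1)).length := by
        rw [length_pow]
        nlinarith
      exact Or.inr ⟨hpow_length _ hu, hpow_length _ hv⟩
  have hsup : (b ⊔ d) u v :=
    (b ⊔ d).trans (le_sup_right (a := b) (identitiesOf_pow_card_succ G u))
      ((b ⊔ d).trans (le_sup_left (b := d) hpow_b)
        ((b ⊔ d).symm (le_sup_right (a := b) (identitiesOf_pow_card_succ G v))))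
  have hmod : (c ⊓ (b ⊔ d)) u v := ⟨huv, hsup⟩
  rw [hum b d hb hd inf_le_left] at hmod
  rcases hle hmod with h | h
  · exact huv_ne h
  · omega
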